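/- Let n ≥ 1, let L_R, L_C ∈ ℝ^{n×n} be symmetric positive semidefinite matrices each with kernel exactly span{1}, let K^P be diagonal with strictly positive diagonal entries, let γ > 0, let K^V = diag(1, 0, …, 0), let V^nom ∈ ℝ and I^inj ∈ ℝ^n. Suppose (V̂, V) ∈ ℝ^n × ℝ^n is an equilibrium of the distributed-averaging closed loop, i.e., 0 = K^V(V^nom·1 − V) − γ L_C(V̂ − V) and 0 = K^P(V̂ − V) − L_R V + I^inj. Then: (a) V₁ = V^nom; (b) V̂ − V = k·1 for the scalar k = −(Σ_{i=1}^n I^inj_i)/(Σ_{i=1}^n K^P_{ii}); and hence (c) the equilibrium controlled injected currents satisfy u = K^P(V̂ − V) = −((Σ_{i=1}^n I^inj_i)/(Σ_{i=1}^n K^P_{ii}))·K^P·1, i.e., u_i/u_j = K^P_{ii}/K^P_{jj} for all i, j (power sharing). -/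

import Mathlib

open Matrix

/-- If a symmetric matrix annihilates the all-ones vector, the entries of each vector in its
range sum to zero. -/
theorem sum_mulVec_eq_zero_of_isSymm {ι R : Type*} [Fintype ι] [CommSemiring R]
    {L : Matrix ι ι R} (hL : L.IsSymm) (hone : L *ᵥ 1 = 0) (x : ι → R) :
    ∑ i, (L *ᵥ x) i = 0 := by
  rw [← one_dotProduct, dotProduct_mulVec, ← mulVec_transpose, hL.eq, hone, zero_dotProduct]

/-- **Theorem 3 (equilibrium / power-sharing part), Andreasson et al.**
Consider an equilibrium `(V̂, V)` of the MTDC system under the distributed averaging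
controller, i.e. `0 = K^V (V^nom 1 - V) - γ L_C (V̂ - V)` and
`0 = K^P (V̂ - V) - L_R V + I^inj`, where `L_R`, `L_C` are symmetric positive semidefinite
with kernel exactly `span{1}`, `K^P` is diagonal with strictly positive entries, `γ > 0`,
and `K^V = diag(1, 0, …, 0)`.  Then:
(a) `V₁ = V^nom`;
(b) `V̂ - V = k 1` with `k = -(∑ i, I^inj_i)/(∑ i, K^P_{ii})`;
(c) the equilibrium controlled injected currents satisfy
    `u = K^P (V̂ - V) = -((∑ i, I^inj_i)/(∑ i, K^P_{ii})) K^P 1` (power sharing). -/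
theorem distributed_controller_equilibrium_power_sharing
    (n : ℕ) (hn : 0 < n)
    (L_R L_C : Matrix (Fin n) (Fin n) ℝ)
    (hLR_psd : L_R.PosSemidef) (hLC_psd : L_C.PosSemidef)
    (hLR_ker : ∀ x : Fin n → ℝ, L_R *ᵥ x = 0 ↔ ∃ c : ℝ, x = fun _ => c)
    (hLC_ker : ∀ x : Fin n → ℝ, L_C *ᵥ x = 0 ↔ ∃ c : ℝ, x = fun _ => c)
    (KPd : Fin n → ℝ) (hKPd : ∀ i, 0 < KPd i)
    (γ : ℝ) (hγ : 0 < γ)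
    (KV : Matrix (Fin n) (Fin n) ℝ)
    (hKV : KV = Matrix.diagonal (fun i : Fin n => if (i : ℕ) = 0 then (1 : ℝ) else 0))
    (Vnom : ℝ) (Iinj : Fin n → ℝ)
    (Vhat V : Fin n → ℝ)
    (heq1 : KV *ᵥ ((fun _ => Vnom) - V) - γ • (L_C *ᵥ (Vhat - V)) = 0)
    (heq2 : Matrix.diagonal KPd *ᵥ (Vhat - V) - L_R *ᵥ V + Iinj = 0) :
    V ⟨0, hn⟩ = Vnom ∧
      Vhat - V = (fun _ => -(∑ i, Iinj i) / (∑ i, KPd i)) ∧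
      Matrix.diagonal KPd *ᵥ (Vhat - V) =
        -((∑ i, Iinj i) / (∑ i, KPd i)) •
          (Matrix.diagonal KPd *ᵥ (fun _ => (1 : ℝ))) := by
  have sum_LR : ∑ i, (L_R *ᵥ V) i = 0 :=
    sum_mulVec_eq_zero_of_isSymm (by simpa using hLR_psd.isHermitian)
      ((hLR_ker 1).2 ⟨1, rfl⟩) V
  have sum_LC : ∑ i, (L_C *ᵥ (Vhat - V)) i = 0 :=
    sum_mulVec_eq_zero_of_isSymm (by simpa using hLC_psd.isHermitian)
      ((hLC_ker 1).2 ⟨1, rfl⟩) (Vhat - V)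
  have hKV_apply (i : Fin n) : (KV *ᵥ ((fun _ => Vnom) - V)) i =
      if i = ⟨0, hn⟩ then Vnom - V ⟨0, hn⟩ else 0 := by
    rw [hKV, mulVec_diagonal]
    by_cases hi : i = ⟨0, hn⟩
    · simp [hi]
    · simp [hi, show (i : ℕ) ≠ 0 from fun h => hi (Fin.ext h)]
  have hV : V ⟨0, hn⟩ = Vnom := by
    have h := congrArg (fun x : Fin n → ℝ => ∑ i, x i) heq1
    simp only [Pi.sub_apply, Pi.smul_apply, smul_eq_mul, Pi.zero_apply, Finset.sum_sub_distrib,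
      ← Finset.mul_sum, sum_LC, hKV_apply, Finset.sum_ite_eq', Finset.mem_univ, if_true,
      Finset.sum_const_zero] at h
    linarith
  have hLC : L_C *ᵥ (Vhat - V) = 0 := by
    have hKV_zero : KV *ᵥ ((fun _ => Vnom) - V) = 0 := by
      ext i
      simp [hKV_apply, hV]
    rw [hKV_zero, zero_sub, neg_eq_zero] at heq1
    exact (smul_eq_zero.1 heq1).resolve_left hγ.ne'
  obtain ⟨k, hk⟩ := (hLC_ker _).1 hLC
  have hKP_sum : 0 < ∑ i, KPd i := Finset.sum_pos (fun i _ => hKPd i) ⟨⟨0, hn⟩, Finset.mem_univ _⟩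
  have hk_eq : k = -(∑ i, Iinj i) / (∑ i, KPd i) := by
    have h := congrArg (fun x : Fin n → ℝ => ∑ i, x i) heq2
    simp only [hk, Pi.add_apply, Pi.sub_apply, Pi.zero_apply, mulVec_diagonal,
      Finset.sum_add_distrib, Finset.sum_sub_distrib, ← Finset.sum_mul, sum_LR,
      Finset.sum_const_zero] at h
    rw [eq_div_iff hKP_sum.ne']
    linarith
  refine ⟨hV, by rw [hk, hk_eq], ?_⟩
  ext i
  simp only [hk, hk_eq, mulVec_diagonal, Pi.smul_apply, smul_eq_mul]
  ring
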